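/- Let n m : ℕ, let A be an invertible n×n real matrix, W an invertible m×m real matrix, B an m×n real matrix, and γ a real number. Set S := B * A⁻¹ * Bᵀ and A_γ := A + γ • (Bᵀ * W⁻¹ * B). If S is invertible and S⁻¹ + γ • W⁻¹ is invertible, then A_γ is invertible and B * A_γ⁻¹ * Bᵀ = (S⁻¹ + γ • W⁻¹)⁻¹; equivalently, (B * A_γ⁻¹ * Bᵀ)⁻¹ = (B * A⁻¹ * Bᵀ)⁻¹ + γ • W⁻¹. -/

import Mathlib

open Matrix

/-- Schur-complement identity for the augmented-Lagrangian regularized block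
`A_γ = A + γ • (Bᵀ * W⁻¹ * B)`. -/
theorem schur_complement_augmented_lagrangian
    (n m : ℕ) (A : Matrix (Fin n) (Fin n) ℝ) (W : Matrix (Fin m) (Fin m) ℝ)
    (B : Matrix (Fin m) (Fin n) ℝ) (γ : ℝ)
    (hA : IsUnit A) (hW : IsUnit W)
    (hS : IsUnit (B * A⁻¹ * Bᵀ))
    (hS' : IsUnit ((B * A⁻¹ * Bᵀ)⁻¹ + γ • W⁻¹)) :
    IsUnit (A + γ • (Bᵀ * W⁻¹ * B)) ∧
      B * (A + γ • (Bᵀ * W⁻¹ * B))⁻¹ * Bᵀ = ((B * A⁻¹ * Bᵀ)⁻¹ + γ • W⁻¹)⁻¹ ∧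
      (B * (A + γ • (Bᵀ * W⁻¹ * B))⁻¹ * Bᵀ)⁻¹ = (B * A⁻¹ * Bᵀ)⁻¹ + γ • W⁻¹ := by
  obtain ⟨C, hC⟩ : ∃ C, C = γ • W⁻¹ := ⟨_, rfl⟩
  have hG : γ • (Bᵀ * W⁻¹ * B) = Bᵀ * (C * B) := by
    rw [hC, Matrix.mul_assoc, Matrix.smul_mul, Matrix.mul_smul]
  rw [hG, ← hC]
  rw [← hC] at hS'
  obtain ⟨S, hSd⟩ : ∃ S, S = B * A⁻¹ * Bᵀ := ⟨_, rfl⟩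
  rw [← hSd] at hS hS' ⊢
  have hAd := (Matrix.isUnit_iff_isUnit_det A).1 hA
  have hSdet := (Matrix.isUnit_iff_isUnit_det S).1 hS
  have hTS : (S⁻¹ + C) * S = 1 + C * S := by
    rw [Matrix.add_mul, Matrix.nonsing_inv_mul _ hSdet]
  have hU : IsUnit (A + Bᵀ * (C * B)) := by
    rw [Matrix.isUnit_iff_isUnit_det, Matrix.det_add_mul _ _ hAd]
    have h1 : 1 + C * B * A⁻¹ * Bᵀ = (S⁻¹ + C) * S := by
      rw [hTS, hSd]; simp only [Matrix.mul_assoc]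
    rw [h1]
    exact hAd.mul ((Matrix.isUnit_iff_isUnit_det _).1 (hS'.mul hS))
  have hUd := (Matrix.isUnit_iff_isUnit_det _).1 hU
  have h2 : (A + Bᵀ * (C * B)) * (A⁻¹ * Bᵀ) = Bᵀ * ((S⁻¹ + C) * S) := by
    rw [hTS, Matrix.add_mul, Matrix.mul_add, Matrix.mul_nonsing_inv_cancel_left _ _ hAd, hSd]
    simp only [Matrix.mul_assoc, Matrix.mul_one]
  have h3 : A⁻¹ * Bᵀ = (A + Bᵀ * (C * B))⁻¹ * (Bᵀ * ((S⁻¹ + C) * S)) := by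
    rw [← h2, Matrix.nonsing_inv_mul_cancel_left _ _ hUd]
  have h4 : (B * (A + Bᵀ * (C * B))⁻¹ * Bᵀ) * (S⁻¹ + C) = 1 := by
    apply hS.mul_right_cancel
    rw [Matrix.one_mul]
    conv_rhs => rw [hSd, Matrix.mul_assoc, h3]
    simp only [Matrix.mul_assoc]
  exact ⟨hU, (Matrix.inv_eq_left_inv h4).symm, Matrix.inv_eq_right_inv h4⟩
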